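/- Let m = 4 and suppose N₂ acts trivially on ZMod 4 (so N₂ = N₀ = N₁). Then 𝒜 equals the set of pointwise preclutching maps ψ such that each ψ_j is N₂-equivariant and ψ₃ ∘ ψ₂ ∘ ψ₁ ∘ ψ₀ = id on W 0. Moreover, for any three pairwise distinct j, j', j'' ∈ ZMod 4, the map ψ ↦ (ψ_j, ψ_{j'}, ψ_{j''}) is a bijection from 𝒜 onto Iso_{N₂}(W j, W (j+1)) × Iso_{N₂}(W j', W (j'+1)) × Iso_{N₂}(W j'', W (j''+1)), where Iso_{N₂}(W i, W (i+1)) denotes the set of N₂-equivariant ℂ-linear equivalences W i ≃ W (i+1). -/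

import Mathlib

noncomputable section

namespace EqClutch

variable {m : ℕ}

/-- The iterate `Ψ_j^k = ψ_{j+k-1} ∘ ⋯ ∘ ψ_{j+1} ∘ ψ_j : W j ≃ W (j+k)` of a pointwise
preclutching map `ψ`. -/
def Psi {V : Type*} [AddCommGroup V] [Module ℂ V] (W : ZMod m → Submodule ℂ V)
    (ψ : ∀ j : ZMod m, W j ≃ₗ[ℂ] W (j + 1)) :
    ∀ (j : ZMod m) (k : ℕ), W j ≃ₗ[ℂ] W (j + (k : ZMod m))
  | j, 0 => LinearEquiv.ofEq _ _ (by norm_num)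
  | j, (k + 1) =>
      ((Psi W ψ j k).trans (ψ (j + (k : ZMod m)))).trans
        (LinearEquiv.ofEq _ _ (by rw [Nat.cast_add, Nat.cast_one, add_assoc]))

/-- `g` lies in the kernel `N₀` of the action of `N₂` on `ZMod m`. -/
def InKernel (N₂ : Type*) [Group N₂] [MulAction N₂ (ZMod m)] (g : N₂) : Prop :=
  ∀ j : ZMod m, g • j = j

/-- `B : p ≃ q` commutes with `ρ g` (equivariance, stated via the ambient space `V`). -/
def IsEquivariantOn {N₂ : Type*} [Group N₂] {V : Type*} [AddCommGroup V] [Module ℂ V]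
    (ρ : N₂ →* (V ≃ₗ[ℂ] V)) {p q : Submodule ℂ V} (B : p ≃ₗ[ℂ] q) (g : N₂) : Prop :=
  ∀ (w w' : p), (w' : V) = ρ g (w : V) → ((B w' : V) = ρ g ((B w : V)))

/-- A pointwise preclutching map `ψ` is an *equivariant pointwise clutching map*:
(1) `Ψ_j^m = id` for every `j`; (2) for every `j₁` and `g ∈ N₂`, with `j₂ = g⁻¹ • j₁`,
`j₃ = g • (j₂ + 1)` and `k ∈ {0, …, m-1}` the representative of `j₃ - j₁`, one has
`Ψ_{j₁}^k = ρ(g) ∘ ψ_{j₂} ∘ ρ(g)⁻¹` as maps `W j₁ → W j₃`. -/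
def IsClutch {N₂ : Type*} [Group N₂] [MulAction N₂ (ZMod m)]
    {V : Type*} [AddCommGroup V] [Module ℂ V]
    (ρ : N₂ →* (V ≃ₗ[ℂ] V)) (W : ZMod m → Submodule ℂ V)
    (ψ : ∀ j : ZMod m, W j ≃ₗ[ℂ] W (j + 1)) : Prop :=
  (∀ (j : ZMod m) (w : W j), ((Psi W ψ j m) w : V) = (w : V)) ∧
  (∀ (j₁ : ZMod m) (g : N₂) (w₁ : W j₁) (w₂ : W (g⁻¹ • j₁)),
      (w₂ : V) = ρ g⁻¹ (w₁ : V) →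
      ((Psi W ψ j₁ ((g • (g⁻¹ • j₁ + 1) - j₁).val)) w₁ : V) =
        ρ g (((ψ (g⁻¹ • j₁)) w₂ : V)))


theorem add_one_add_natCast {n : ℕ} (i : ZMod (n + 1)) : i + 1 + (n : ZMod (n + 1)) = i := by
  have h : ((n + 1 : ℕ) : ZMod (n + 1)) = 0 := ZMod.natCast_self _
  push_cast at h
  rw [add_assoc, add_comm 1, h, add_zero]

theorem add_one_add_natCast_ne {n t : ℕ} (i : ZMod (n + 1)) (ht : t < n) :
    i + 1 + (t : ZMod (n + 1)) ≠ i := by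
  intro h
  have h0 : ((t + 1 : ℕ) : ZMod (n + 1)) = 0 := by
    push_cast
    linear_combination h
  have := Nat.le_of_dvd t.succ_pos ((ZMod.natCast_eq_zero_iff _ _).1 h0)
  omega

section Iterates

variable {V : Type*} [AddCommGroup V] [Module ℂ V] {W : ZMod m → Submodule ℂ V}

theorem coe_apply_congr (ψ : ∀ j : ZMod m, W j ≃ₗ[ℂ] W (j + 1)) {i j : ZMod m} (h : i = j)
    (x : W i) (y : W j) (hxy : (x : V) = y) : (ψ i x : V) = ψ j y := by
  subst h
  rw [Subtype.ext hxy]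

theorem coe_Psi_zero (ψ : ∀ j : ZMod m, W j ≃ₗ[ℂ] W (j + 1)) (j : ZMod m) (w : W j) :
    (Psi W ψ j 0 w : V) = w :=
  rfl

theorem coe_Psi_succ (ψ : ∀ j : ZMod m, W j ≃ₗ[ℂ] W (j + 1)) (j : ZMod m) (k : ℕ) (w : W j) :
    (Psi W ψ j (k + 1) w : V) = ψ (j + (k : ZMod m)) (Psi W ψ j k w) :=
  rfl

theorem coe_Psi_one (ψ : ∀ j : ZMod m, W j ≃ₗ[ℂ] W (j + 1)) (j : ZMod m) (w : W j) :
    (Psi W ψ j 1 w : V) = ψ j w := by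
  rw [coe_Psi_succ]
  exact coe_apply_congr ψ (by simp) _ _ (coe_Psi_zero ψ j w)

/-- The recursion for `Psi` that splits off the first factor instead of the last one. -/
theorem coe_Psi_succ_left (ψ : ∀ j : ZMod m, W j ≃ₗ[ℂ] W (j + 1)) (j : ZMod m) (k : ℕ)
    (w : W j) : (Psi W ψ j (k + 1) w : V) = Psi W ψ (j + 1) k (ψ j w) := by
  induction k with
  | zero => rw [coe_Psi_one, coe_Psi_zero]
  | succ k ih =>
    rw [coe_Psi_succ, coe_Psi_succ]
    exact coe_apply_congr ψ (by push_cast; ring) _ _ ih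

/-- `Psi W ψ j k` depends only on `ψ j, …, ψ (j + k - 1)`. -/
theorem coe_Psi_congr {ψ φ : ∀ j : ZMod m, W j ≃ₗ[ℂ] W (j + 1)} (j : ZMod m) (k : ℕ)
    (h : ∀ t < k, ψ (j + (t : ZMod m)) = φ (j + (t : ZMod m))) (w : W j) :
    (Psi W ψ j k w : V) = Psi W φ j k w := by
  induction k with
  | zero => rfl
  | succ k ih =>
    rw [coe_Psi_succ, coe_Psi_succ, h k k.lt_succ_self]
    exact coe_apply_congr φ rfl _ _ (ih fun t ht => h t (by omega))

theorem coe_Psi_period_add_one (ψ : ∀ j : ZMod m, W j ≃ₗ[ℂ] W (j + 1)) (j : ZMod m)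
    (h : ∀ w : W j, (Psi W ψ j m w : V) = w) (w : W (j + 1)) :
    (Psi W ψ (j + 1) m w : V) = w := by
  obtain ⟨v, rfl⟩ := (ψ j).surjective w
  rw [← coe_Psi_succ_left, coe_Psi_succ]
  exact coe_apply_congr ψ (by simp) _ _ (h v)

/-- If one of the full composites `Psi W ψ j m` is the identity, then all of them are. -/
theorem coe_Psi_period [NeZero m] (ψ : ∀ j : ZMod m, W j ≃ₗ[ℂ] W (j + 1)) (i : ZMod m)
    (h : ∀ w : W i, (Psi W ψ i m w : V) = w) (j : ZMod m) (w : W j) :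
    (Psi W ψ j m w : V) = w := by
  have key : ∀ (n : ℕ) (j : ZMod m), j = i + n → ∀ w : W j, (Psi W ψ j m w : V) = w := by
    intro n
    induction n with
    | zero =>
      rintro j hj
      obtain rfl : j = i := by simpa using hj
      exact h
    | succ n ih =>
      rintro j hj
      obtain rfl : j = i + n + 1 := by rw [hj]; push_cast; ring
      exact coe_Psi_period_add_one ψ _ (ih _ rfl)
  exact key (j - i).val j (by rw [ZMod.natCast_zmod_val]; ring) w

variable {N₂ : Type*} [Group N₂] {ρ : N₂ →* (V ≃ₗ[ℂ] V)}

theorem IsEquivariantOn.Psi {ψ : ∀ j : ZMod m, W j ≃ₗ[ℂ] W (j + 1)} {g : N₂}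
    (h : ∀ j, IsEquivariantOn ρ (ψ j) g) (j : ZMod m) (k : ℕ) :
    IsEquivariantOn ρ (Psi W ψ j k) g := by
  intro w w' hw
  induction k with
  | zero => exact hw
  | succ k ih => exact h _ _ _ ih

theorem IsEquivariantOn.symm {p q : Submodule ℂ V} {B : p ≃ₗ[ℂ] q} {g : N₂}
    (h : IsEquivariantOn ρ B g) (hp : ∀ v ∈ p, ρ g v ∈ p) : IsEquivariantOn ρ B.symm g := by
  intro w w' hw
  have h1 := h (B.symm w) ⟨_, hp _ (B.symm w).2⟩ rfl
  rw [B.apply_symm_apply, ← hw] at h1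
  rw [← Subtype.ext h1, B.symm_apply_apply]

/-- For a trivial action on the base, a clutching map is a family of equivariant maps one of whose
full composites is the identity. -/
theorem isClutch_iff_of_trivial [Fact (1 < m)] [MulAction N₂ (ZMod m)]
    (htriv : ∀ (g : N₂) (j : ZMod m), g • j = j) (ψ : ∀ j : ZMod m, W j ≃ₗ[ℂ] W (j + 1))
    (i : ZMod m) :
    IsClutch ρ W ψ ↔ (∀ (j : ZMod m) (g : N₂), IsEquivariantOn ρ (ψ j) g) ∧
      ∀ w : W i, (Psi W ψ i m w : V) = w := by
  have : NeZero m := ⟨by have := Fact.out (p := 1 < m); omega⟩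
  have hk : ∀ (j : ZMod m) (g : N₂), (g • (g⁻¹ • j + 1) - j).val = 1 := fun j g => by
    rw [htriv, htriv, add_sub_cancel_left, ZMod.val_one]
  have hinv : ∀ (g : N₂) (v : V), ρ g⁻¹ (ρ g v) = v := fun g v => by
    rw [← LinearEquiv.mul_apply, ← map_mul, inv_mul_cancel, map_one, LinearEquiv.coe_one, id]
  have hinv' : ∀ (g : N₂) (v : V), ρ g (ρ g⁻¹ v) = v := fun g v => by
    rw [← LinearEquiv.mul_apply, ← map_mul, mul_inv_cancel, map_one, LinearEquiv.coe_one, id]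
  constructor
  · rintro ⟨h1, h2⟩
    refine ⟨fun j g w w' hw => ?_, h1 i⟩
    have h3 := h2 j g w' ⟨w, by rw [htriv]; exact w.2⟩ (by rw [hw, hinv])
    rw [hk, coe_Psi_one] at h3
    rw [h3]
    exact congrArg _ (coe_apply_congr ψ (htriv _ _) _ _ rfl)
  · rintro ⟨h1, h2⟩
    refine ⟨coe_Psi_period ψ i h2, fun j g w₁ w₂ hw => ?_⟩
    have hmem : (w₂ : V) ∈ W j := (congrArg W (htriv g⁻¹ j)).le w₂.2
    rw [hk, coe_Psi_one, h1 j g ⟨w₂, hmem⟩ w₁ (by rw [hw, hinv'])]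
    exact congrArg _ (coe_apply_congr ψ (htriv _ _).symm _ _ rfl)

/-- A family whose full composites are the identity is determined away from any one index. -/
theorem eq_of_Psi_period {n : ℕ} {W : ZMod (n + 1) → Submodule ℂ V}
    {ψ φ : ∀ j : ZMod (n + 1), W j ≃ₗ[ℂ] W (j + 1)} (i : ZMod (n + 1))
    (hψ : ∀ w : W (i + 1), (Psi W ψ (i + 1) (n + 1) w : V) = w)
    (hφ : ∀ w : W (i + 1), (Psi W φ (i + 1) (n + 1) w : V) = w)
    (h : ∀ j ≠ i, ψ j = φ j) : ψ = φ := by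
  have hi : i + 1 + (n : ZMod (n + 1)) = i := add_one_add_natCast i
  funext j
  by_cases hj : j = i
  · subst hj
    ext x
    obtain ⟨w, hw⟩ := (Psi W ψ (j + 1) n).surjective ⟨x, by rw [hi]; exact x.2⟩
    have hwx : (Psi W ψ (j + 1) n w : V) = x := congrArg Subtype.val hw
    have hwx' : (Psi W φ (j + 1) n w : V) = x := by
      rw [← hwx]
      exact (coe_Psi_congr _ _ (fun t ht => h _ (add_one_add_natCast_ne j ht)) w).symm
    have h1 := hψ w
    have h2 := hφ w
    rw [coe_Psi_succ] at h1 h2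
    rw [← coe_apply_congr ψ hi _ x hwx, ← coe_apply_congr φ hi _ x hwx', h1, h2]
  · exact h j hj

/-- Away from any one index, a family can be corrected so that its full composites become the
identity, preserving equivariance. -/
theorem exists_Psi_period {n : ℕ} {W : ZMod (n + 1) → Submodule ℂ V}
    (hW : ∀ (g : N₂) (j : ZMod (n + 1)), ∀ v ∈ W j, ρ g v ∈ W j)
    (φ : ∀ j : ZMod (n + 1), W j ≃ₗ[ℂ] W (j + 1)) (hφ : ∀ j g, IsEquivariantOn ρ (φ j) g)
    (i : ZMod (n + 1)) :
    ∃ ψ : ∀ j : ZMod (n + 1), W j ≃ₗ[ℂ] W (j + 1), (∀ j g, IsEquivariantOn ρ (ψ j) g) ∧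
      (∀ w : W (i + 1), (Psi W ψ (i + 1) (n + 1) w : V) = w) ∧ ∀ j ≠ i, ψ j = φ j := by
  have hi : i + 1 + (n : ZMod (n + 1)) = i := add_one_add_natCast i
  set B : W i ≃ₗ[ℂ] W (i + 1) :=
    (LinearEquiv.ofEq _ _ (by rw [hi])).trans (Psi W φ (i + 1) n).symm with hB
  have hne : ∀ j ≠ i, Function.update φ i B j = φ j := fun j hj =>
    Function.update_of_ne hj _ _
  refine ⟨Function.update φ i B, fun j g => ?_, fun w => ?_, hne⟩
  · by_cases hj : j = i
    · subst hj
      rw [Function.update_self]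
      intro w w' hw
      exact (IsEquivariantOn.Psi (fun j => hφ j g) (j + 1) n).symm (hW g _) _ _ hw
    · rw [hne j hj]
      exact hφ j g
  · have hw : (Psi W (Function.update φ i B) (i + 1) n w : V) = Psi W φ (i + 1) n w :=
      coe_Psi_congr _ _ (fun t ht => hne _ (add_one_add_natCast_ne i ht)) w
    rw [coe_Psi_succ, coe_apply_congr (Function.update φ i B) hi _
      ⟨Psi W φ (i + 1) n w, (congrArg W hi).le (Psi W φ (i + 1) n w).2⟩ hw,
      Function.update_self, hB, LinearEquiv.trans_apply]
    exact congrArg Subtype.val ((Psi W φ (i + 1) n).symm_apply_apply w)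

end Iterates

/-- Let `m = 4` and suppose `N₂` acts trivially on `ZMod 4`.  Then `𝒜`
is exactly the set of pointwise preclutching maps `ψ` with every `ψ_j` `N₂`-equivariant and
`ψ₃ ∘ ψ₂ ∘ ψ₁ ∘ ψ₀ = id`.  Moreover, for pairwise distinct `j, j', j''`, evaluation
`ψ ↦ (ψ_j, ψ_{j'}, ψ_{j''})` is a bijection from `𝒜` onto
`Iso_{N₂}(W j, W (j+1)) × Iso_{N₂}(W j', W (j'+1)) × Iso_{N₂}(W j'', W (j''+1))`. -/
theorem stmt_14 {N₂ : Type*} [Group N₂] [MulAction N₂ (ZMod 4)]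
    {V : Type*} [AddCommGroup V] [Module ℂ V] [FiniteDimensional ℂ V]
    (ρ : N₂ →* (V ≃ₗ[ℂ] V)) (W : ZMod 4 → Submodule ℂ V)
    (hIndep : ∀ j : ZMod 4, Disjoint (W j) (⨆ k : ZMod 4, ⨆ (_ : k ≠ j), W k))
    (hSpan : (⨆ j : ZMod 4, W j) = ⊤)
    (hWρ : ∀ (g : N₂) (j : ZMod 4), (W j).map (ρ g).toLinearMap = W (g • j))
    (hfib : ∀ j j' : ZMod 4, ∃ e : W j ≃ₗ[ℂ] W j',
      ∀ g : N₂, InKernel (m := 4) N₂ g → IsEquivariantOn ρ e g)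
    (htriv : ∀ (g : N₂) (j : ZMod 4), g • j = j) :
    -- `𝒜` consists exactly of the families of `N₂`-equivariant equivalences whose
    -- total composite `Ψ₀⁴ = ψ₃ ∘ ψ₂ ∘ ψ₁ ∘ ψ₀` is the identity …
    (∀ ψ : ∀ j : ZMod 4, W j ≃ₗ[ℂ] W (j + 1),
      IsClutch ρ W ψ ↔
        ((∀ (j : ZMod 4) (g : N₂), IsEquivariantOn ρ (ψ j) g) ∧
          (∀ w : W 0, ((Psi W ψ 0 4) w : V) = (w : V)))) ∧
    -- … and for pairwise distinct `j, j', j''` the triple evaluation map is bijective: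
    (∀ j j' j'' : ZMod 4, j ≠ j' → j ≠ j'' → j' ≠ j'' →
      (Function.Injective
        (fun ψ : {ψ : ∀ i : ZMod 4, W i ≃ₗ[ℂ] W (i + 1) // IsClutch ρ W ψ} =>
          (ψ.1 j, ψ.1 j', ψ.1 j'')) ∧
      (∀ (B : W j ≃ₗ[ℂ] W (j + 1)) (B' : W j' ≃ₗ[ℂ] W (j' + 1))
          (B'' : W j'' ≃ₗ[ℂ] W (j'' + 1)),
        (∀ g : N₂, IsEquivariantOn ρ B g) →
        (∀ g : N₂, IsEquivariantOn ρ B' g) →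
        (∀ g : N₂, IsEquivariantOn ρ B'' g) →
        ∃ ψ : ∀ i : ZMod 4, W i ≃ₗ[ℂ] W (i + 1), IsClutch ρ W ψ ∧
          ψ j = B ∧ ψ j' = B' ∧ ψ j'' = B''))) := by
  have : Fact (1 < 4) := ⟨by norm_num⟩
  have hiff := isClutch_iff_of_trivial (ρ := ρ) (W := W) htriv
  have hW : ∀ (g : N₂) (j : ZMod 4), ∀ v ∈ W j, ρ g v ∈ W j := fun g j v hv => by
    have h := Submodule.mem_map_of_mem (f := (ρ g).toLinearMap) hv
    rwa [hWρ, htriv] at h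
  have hfourth : ∀ j j' j'' : ZMod 4, j ≠ j' → j ≠ j'' → j' ≠ j'' →
      ∃ i, j ≠ i ∧ j' ≠ i ∧ j'' ≠ i ∧ ∀ l ≠ i, l = j ∨ l = j' ∨ l = j'' := by
    decide
  refine ⟨fun ψ => hiff ψ 0, fun j j' j'' h₁ h₂ h₃ => ?_⟩
  obtain ⟨i, hj, hj', hj'', hi⟩ := hfourth j j' j'' h₁ h₂ h₃
  constructor
  · rintro ⟨ψ, hψ⟩ ⟨φ, hφ⟩ h
    simp only [Prod.mk.injEq] at h
    refine Subtype.ext (eq_of_Psi_period i (hψ.1 _) (hφ.1 _) fun l hl => ?_)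
    rcases hi l hl with rfl | rfl | rfl
    exacts [h.1, h.2.1, h.2.2]
  · intro B B' B'' hB hB' hB''
    choose e he using fun j : ZMod 4 => hfib j (j + 1)
    obtain ⟨ψ, hψ, hper, hagree⟩ := exists_Psi_period hW
      (Function.update (Function.update (Function.update e j B) j' B') j'' B'')
      (fun l g => by
        by_cases hl : l = i
        · subst hl
          rw [Function.update_of_ne hj''.symm, Function.update_of_ne hj'.symm,
            Function.update_of_ne hj.symm]
          exact he l g (htriv g)
        · rcases hi l hl with rfl | rfl | rfl
          · rw [Function.update_of_ne h₂, Function.update_of_ne h₁, Function.update_self]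
            exact hB g
          · rw [Function.update_of_ne h₃, Function.update_self]
            exact hB' g
          · rw [Function.update_self]
            exact hB'' g) i
    refine ⟨ψ, (hiff ψ (i + 1)).2 ⟨hψ, hper⟩, ?_, ?_, ?_⟩
    · rw [hagree j hj, Function.update_of_ne h₂, Function.update_of_ne h₁, Function.update_self]
    · rw [hagree j' hj', Function.update_of_ne h₃, Function.update_self]
    · rw [hagree j'' hj'', Function.update_self]

end EqClutch
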